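/- Suppose W' ⊆ W_B and the labeling l : U_B ∪ W_B → {1,…,R} satisfy every constraint edge (u, w) of the Unique Games instance with w ∈ W'. Consider the fire process on G where on day i (1 ≤ i ≤ b) the saved set is {(w, v^i_x) : w ∈ W', x_{l(w)} = * or B_{i−1} + 1 ≤ x_{l(w)} ≤ B_i} ∪ {(w, v^i_x) : w ∉ W'}; that is, Burn_0 = {s}, Saved_i is the union of the saved sets of days 1 through min(i,b), and Burn_i = Burn_{i−1} ∪ (N(Burn_{i−1}) ∖ Saved_i). Then t ∉ Burn_i for every i ≥ 0. -/

import Mathlib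

/-- Vertices of the composed graph `G` for RMFC: `s`, `t`, and `(w, v^i_x)` for
`w ∈ W_B`, `1 ≤ i ≤ b`, `x ∈ Ω^R`, where `Ω = {*, 1, …, B}` is encoded by
`Option (Fin B)` with `none = *` and `some c` standing for the value `c.val + 1`. -/
inductive GFV (B R : ℕ) (W : Type) where
  | s | t
  | v (w : W) (i : ℕ) (x : Fin R → Option (Fin B))

/-- `x, y ∈ Ω^R` are compatible if for every `j`, `y_j = x_j` or `y_j = *` or `x_j = *`. -/
def fcomp {B R : ℕ} (x y : Fin R → Option (Fin B)) : Prop :=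
  ∀ j, y j = x j ∨ y j = none ∨ x j = none

/-- Edges of the composed graph `G`: `{s, (w, v^1_x)}` and `{(w, v^b_x), t}` for all
`w, x`; and for every `u ∈ U_B`, every pair of neighbors `w₁, w₂` of `u`, and every
compatible pair `x, y`, an edge `{(w₁, v^i_{x∘π(u,w₁)}), (w₂, v^{i+1}_{y∘π(u,w₂)})}`. -/
def gfAdj (b : ℕ) {B R : ℕ} {U W : Type} (EB : U → W → Prop)
    (π : U → W → Equiv.Perm (Fin R)) : GFV B R W → GFV B R W → Prop
  | .s, .v _ i _ => i = 1
  | .v _ i _, .t => i = b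
  | .v w1 i x1, .v w2 j x2 =>
      j = i + 1 ∧ 1 ≤ i ∧ j ≤ b ∧
        ∃ u, EB u w1 ∧ EB u w2 ∧ ∃ x y, fcomp x y ∧
          x1 = (fun m => x (π u w1 m)) ∧ x2 = (fun m => y (π u w2 m))
  | _, _ => False

/-- Neighbors in `G` of a set of vertices. -/
def gfN (b : ℕ) {B R : ℕ} {U W : Type} (EB : U → W → Prop)
    (π : U → W → Equiv.Perm (Fin R)) (A : Set (GFV B R W)) : Set (GFV B R W) :=
  {z | ∃ w ∈ A, gfAdj b EB π w z ∨ gfAdj b EB π z w}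

/-- The threshold `B_i = (b!)²·H_i`, an integer: `B_i = Σ_{j=1}^i (b!·b!)/j`. -/
def Bthr (b i : ℕ) : ℕ := ∑ j ∈ Finset.Icc 1 i, Nat.factorial b * Nat.factorial b / j

/-- `B = b!·Σ_{i=1}^b (b!/i)`. -/
def Bval (b : ℕ) : ℕ := Nat.factorial b * ∑ i ∈ Finset.Icc 1 b, Nat.factorial b / i

/-- The set saved on day `j`:
`{(w, v^j_x) : w ∈ W', x_{l(w)} = * or B_{j-1}+1 ≤ x_{l(w)} ≤ B_j} ∪ {(w, v^j_x) : w ∉ W'}`.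
Since `some c` encodes the value `c.val + 1`, the condition `B_{j-1}+1 ≤ x_{l(w)} ≤ B_j`
reads `B_{j-1} ≤ c.val < B_j`. -/
def gfSavedDay (b : ℕ) {B R : ℕ} {W : Type} (W' : Set W) (lW : W → Fin R) (j : ℕ) :
    Set (GFV B R W) :=
  {z | ∃ w x, z = GFV.v w j x ∧
    ((w ∈ W' ∧ (x (lW w) = none ∨
        ∃ c : Fin B, x (lW w) = some c ∧ Bthr b (j - 1) ≤ c.val ∧ c.val < Bthr b j)) ∨
      w ∉ W')}

/-- All vertices saved by day `i`: `Saved_i = ∪_{1 ≤ j ≤ min(i,b)}` (day-`j` saved set). -/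
def gfSaved (b : ℕ) {B R : ℕ} {W : Type} (W' : Set W) (lW : W → Fin R) (i : ℕ) :
    Set (GFV B R W) :=
  ⋃ j ∈ Finset.Icc 1 (min i b), gfSavedDay b W' lW j

/-- The fire process on `G`: `Burn_0 = {s}` and
`Burn_{i+1} = Burn_i ∪ (N(Burn_i) \ Saved_{i+1})`. -/
def gfBurn (b : ℕ) {B R : ℕ} {U W : Type} (EB : U → W → Prop)
    (π : U → W → Equiv.Perm (Fin R)) (W' : Set W) (lW : W → Fin R) :
    ℕ → Set (GFV B R W)
  | 0 => {GFV.s}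
  | (i + 1) => gfBurn b EB π W' lW i ∪
      (gfN b EB π (gfBurn b EB π W' lW i) \ gfSaved b W' lW (i + 1))

theorem Bthr_mono (b : ℕ) : Monotone (Bthr b) := fun _ _ h =>
  Finset.sum_le_sum_of_subset (Finset.Icc_subset_Icc_right h)

theorem Bthr_self (b : ℕ) : Bthr b b = Bval b := by
  unfold Bthr Bval
  rw [Finset.mul_sum]
  refine Finset.sum_congr rfl fun j hj => ?_
  rw [Finset.mem_Icc] at hj
  exact Nat.mul_div_assoc _ (Nat.dvd_factorial hj.1 hj.2)

/-- A vertex of layer `j` that escapes the first `i ≥ j` days of saving lies over `W'`, and its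
value at the label of its `W`-part is an integer outside the range saved on day `j`. -/
theorem exists_of_notMem_gfSaved {b B R i j : ℕ} {W : Type} {W' : Set W} {lW : W → Fin R}
    {w : W} {x : Fin R → Option (Fin B)} (hj : 1 ≤ j) (hjb : j ≤ b) (hji : j ≤ i)
    (h : GFV.v w j x ∉ gfSaved b W' lW i) :
    w ∈ W' ∧ ∃ c : Fin B, x (lW w) = some c ∧ (Bthr b (j - 1) ≤ c.val → Bthr b j ≤ c.val) := by
  have h' : GFV.v w j x ∉ gfSavedDay b W' lW j := fun hm =>
    h (Set.mem_biUnion (Finset.mem_Icc.2 ⟨hj, le_min hji hjb⟩) hm)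
  have hw : w ∈ W' := by
    by_contra hw
    exact h' ⟨w, x, rfl, Or.inr hw⟩
  refine ⟨hw, ?_⟩
  cases hx : x (lW w) with
  | none => exact (h' ⟨w, x, rfl, Or.inl ⟨hw, Or.inl hx⟩⟩).elim
  | some c =>
    refine ⟨c, rfl, fun hc => ?_⟩
    by_contra hlt
    exact h' ⟨w, x, rfl, Or.inl ⟨hw, Or.inr ⟨c, hx, hc, not_le.1 hlt⟩⟩⟩

/-- Adjacent vertices over `W'` that carry integers at their labels carry the same integer. -/
theorem eq_of_gfAdj {b B R j k : ℕ} {U W : Type} {EB : U → W → Prop}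
    {π : U → W → Equiv.Perm (Fin R)} {W' : Set W} {lU : U → Fin R} {lW : W → Fin R}
    (hsat : ∀ u w, EB u w → w ∈ W' → lU u = π u w (lW w))
    {w₁ w₂ : W} {x₁ x₂ : Fin R → Option (Fin B)} (hw₁ : w₁ ∈ W') (hw₂ : w₂ ∈ W')
    {c₁ c₂ : Fin B} (hc₁ : x₁ (lW w₁) = some c₁) (hc₂ : x₂ (lW w₂) = some c₂)
    (h : gfAdj b EB π (.v w₁ j x₁) (.v w₂ k x₂)) : c₁ = c₂ := by
  obtain ⟨-, -, -, u, hu₁, hu₂, x, y, hxy, rfl, rfl⟩ := h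
  simp only [← hsat u w₁ hu₁ hw₁] at hc₁
  simp only [← hsat u w₂ hu₂ hw₂] at hc₂
  have := hxy (lU u)
  simp_all

/-- What may be burnt by day `i`: `s`, and vertices over `W'` in the first `i` layers whose value
at the label exceeds the threshold of their layer. -/
def GFV.Burnable (b : ℕ) {B R : ℕ} {W : Type} (W' : Set W) (lW : W → Fin R) (i : ℕ) :
    GFV B R W → Prop
  | .s => True
  | .t => False
  | .v w j x => 1 ≤ j ∧ j ≤ b ∧ j ≤ i ∧ w ∈ W' ∧ ∃ c : Fin B, x (lW w) = some c ∧ Bthr b j ≤ c.val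

theorem burnable_of_mem_gfBurn {b R : ℕ} (hb : 1 ≤ b) {U W : Type} {EB : U → W → Prop}
    {π : U → W → Equiv.Perm (Fin R)} {W' : Set W} {lU : U → Fin R} {lW : W → Fin R}
    (hsat : ∀ u w, EB u w → w ∈ W' → lU u = π u w (lW w)) (i : ℕ) :
    ∀ z ∈ gfBurn (B := Bval b) b EB π W' lW i, z.Burnable b W' lW i := by
  induction i with
  | zero =>
    rintro z rfl
    trivial
  | succ i ih =>
    rintro z (hz | ⟨⟨y, hy, hadj⟩, hs⟩)
    · have := ih z hz
      cases z with
      | s => trivial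
      | t => exact this
      | v w j x =>
        obtain ⟨h1, h2, h3, h4⟩ := this
        exact ⟨h1, h2, h3.trans i.le_succ, h4⟩
    · have hyb := ih y hy
      cases y with
      | t => exact hyb.elim
      | s =>
        rcases z with _ | _ | ⟨w, j, x⟩
        · trivial
        · exact (hadj.elim id id).elim
        · obtain rfl : j = 1 := hadj.elim id False.elim
          obtain ⟨hw, c, hc, hle⟩ := exists_of_notMem_gfSaved le_rfl hb (by omega) hs
          exact ⟨le_rfl, hb, by omega, hw, c, hc, hle (by simp [Bthr])⟩
      | v w j x =>
        obtain ⟨hj, hjb, hji, hw, c, hc, hle⟩ := hyb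
        rcases z with _ | _ | ⟨w', k, x'⟩
        · trivial
        · obtain rfl : j = b := hadj.elim id False.elim
          rw [Bthr_self] at hle
          exact absurd c.isLt (not_lt.2 hle)
        · rcases hadj with hadj | hadj
          · obtain ⟨rfl, -, hkb, -⟩ := id hadj
            obtain ⟨hw', c', hc', hle'⟩ :=
              exists_of_notMem_gfSaved (by omega) hkb (by omega) hs
            obtain rfl := eq_of_gfAdj hsat hw hw' hc hc' hadj
            exact ⟨by omega, hkb, by omega, hw', c, hc', hle' hle⟩
          · obtain ⟨rfl, hk, -, -⟩ := id hadj
            obtain ⟨hw', c', hc', -⟩ :=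
              exists_of_notMem_gfSaved hk (by omega) (by omega) hs
            obtain rfl := eq_of_gfAdj hsat hw' hw hc' hc hadj
            exact ⟨hk, by omega, by omega, hw', c', hc', (Bthr_mono b k.le_succ).trans hle⟩

/-- If the labeling `(lU, lW)` satisfies every constraint edge `(u, w)` of the Unique
Games instance with `w ∈ W'`, then in the fire process on the composed graph `G`
(with `B = Bval b`) under the stated saving strategy, `t` is never burnt. -/
theorem stmt15 (b R : ℕ) (hb : 1 ≤ b) (hR : 1 ≤ R)
    {U W : Type} (EB : U → W → Prop) (π : U → W → Equiv.Perm (Fin R))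
    (W' : Set W) (lU : U → Fin R) (lW : W → Fin R)
    (hsat : ∀ u w, EB u w → w ∈ W' → lU u = π u w (lW w))
    (i : ℕ) :
    GFV.t ∉ gfBurn (B := Bval b) b EB π W' lW i :=
  burnable_of_mem_gfBurn hb hsat i GFV.t
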